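/- arXiv:2105.13671 — 6 statements merged into one kernel-verified Lean document; each statement's English description precedes it below -/
import Mathlib

section
/- The vector −z belongs to the closure of the range of L (approximate controllability) if and only if ‖L u_β + z‖_H → 0 as β → 0⁺, where for each β > 0, u_β denotes the unique minimizer of F_β. -/
open Filter Topology

/-- `-z` belongs to the closure of the range of `L` (approximate
controllability) if and only if `‖L u_β + z‖ → 0` as `β → 0⁺`, where for each
`β > 0`, `u β` is a minimizer of the penalized HUM functional `F_β`. -/
theorem stmt1
    {U H : Type*} [NormedAddCommGroup U] [InnerProductSpace ℝ U] [CompleteSpace U]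
    [NormedAddCommGroup H] [InnerProductSpace ℝ H] [CompleteSpace H]
    (L : U →L[ℝ] H) (z : H) (u : ℝ → U)
    (hmin : ∀ β : ℝ, 0 < β → ∀ v : U,
      (1 / 2) * ‖u β‖ ^ 2 + (1 / (2 * β)) * ‖L (u β) + z‖ ^ 2 ≤
        (1 / 2) * ‖v‖ ^ 2 + (1 / (2 * β)) * ‖L v + z‖ ^ 2) :
    (-z ∈ closure (Set.range fun v : U => L v)) ↔
      Tendsto (fun β : ℝ => ‖L (u β) + z‖) (𝓝[>] (0 : ℝ)) (𝓝 0) := by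
  constructor
  · intro hz
    rw [Metric.mem_closure_iff] at hz
    rw [Metric.tendsto_nhds]
    intro ε hε
    obtain ⟨_, ⟨v, rfl⟩, hv⟩ := hz (ε / 2) (by positivity)
    have hv' : ‖L v + z‖ < ε / 2 := by
      rw [dist_comm, dist_eq_norm, sub_neg_eq_add] at hv
      exact hv
    have hδ : 0 < ε ^ 2 / 2 / (‖v‖ ^ 2 + 1) := by positivity
    filter_upwards [Ioo_mem_nhdsGT hδ] with β hβ
    obtain ⟨h0, h1⟩ := hβ
    rw [lt_div_iff₀ (by positivity)] at h1
    have h2 := mul_le_mul_of_nonneg_left (hmin β h0 v) (by positivity : 0 ≤ 2 * β)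
    have e : ∀ a b : ℝ, 2 * β * (1 / 2 * a + 1 / (2 * β) * b) = β * a + b := by
      intro a b
      field_simp
    rw [e, e] at h2
    have h3 : 0 ≤ β * ‖u β‖ ^ 2 := by positivity
    have h4 : ‖L v + z‖ ^ 2 ≤ (ε / 2) ^ 2 := by gcongr
    rw [dist_zero_right, norm_norm]
    apply lt_of_pow_lt_pow_left₀ 2 hε.le
    nlinarith [sq_nonneg ε]
  · intro h
    refine mem_closure_of_tendsto (f := fun β => L (u β)) (b := 𝓝[>] (0 : ℝ)) ?_
      (Eventually.of_forall fun β => ⟨u β, rfl⟩)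
    rw [tendsto_iff_norm_sub_tendsto_zero]
    simpa only [sub_neg_eq_add] using h
end

section
/- Assume there exists û ∈ U with L û + z = 0 (null controllability). Then E := 2·sup_{β>0} inf_{u∈U} F_β(u) is finite, and for every β > 0 the unique minimizer u_β of F_β satisfies ‖u_β‖_U ≤ √E and ‖L u_β + z‖_H ≤ √(E·β). -/
open Filter Topology

/-- assume null controllability, i.e. `∃ û, L û + z = 0`. Then
`E := 2 sup_{β>0} inf_{u∈U} F_β(u)` is finite (the family of infima is bounded
above), and for every `β > 0` the minimizer `u_β` of `F_β` satisfies
`‖u_β‖ ≤ √E` and `‖L u_β + z‖ ≤ √(E β)`. -/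
theorem stmt2
    {U H : Type*} [NormedAddCommGroup U] [InnerProductSpace ℝ U] [CompleteSpace U]
    [NormedAddCommGroup H] [InnerProductSpace ℝ H] [CompleteSpace H]
    (L : U →L[ℝ] H) (z : H) (u : ℝ → U)
    (hmin : ∀ β : ℝ, 0 < β → ∀ v : U,
      (1 / 2) * ‖u β‖ ^ 2 + (1 / (2 * β)) * ‖L (u β) + z‖ ^ 2 ≤
        (1 / 2) * ‖v‖ ^ 2 + (1 / (2 * β)) * ‖L v + z‖ ^ 2)
    (hnull : ∃ w : U, L w + z = 0) :
    BddAbove (Set.range fun β : {β : ℝ // 0 < β} =>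
      ⨅ v : U, ((1 / 2) * ‖v‖ ^ 2 + (1 / (2 * β.1)) * ‖L v + z‖ ^ 2)) ∧
    ∀ β : ℝ, 0 < β →
      ‖u β‖ ≤ Real.sqrt (2 * ⨆ β' : {β : ℝ // 0 < β},
          ⨅ v : U, ((1 / 2) * ‖v‖ ^ 2 + (1 / (2 * β'.1)) * ‖L v + z‖ ^ 2)) ∧
      ‖L (u β) + z‖ ≤ Real.sqrt ((2 * ⨆ β' : {β : ℝ // 0 < β},
          ⨅ v : U, ((1 / 2) * ‖v‖ ^ 2 + (1 / (2 * β'.1)) * ‖L v + z‖ ^ 2)) * β) := by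
  have hbdd : BddAbove (Set.range fun β : {β : ℝ // 0 < β} =>
      ⨅ v : U, ((1 / 2) * ‖v‖ ^ 2 + (1 / (2 * β.1)) * ‖L v + z‖ ^ 2)) := by
    obtain ⟨w, hw⟩ := hnull
    refine ⟨(1 / 2) * ‖w‖ ^ 2, ?_⟩
    rintro _ ⟨β, rfl⟩
    have hb : BddBelow (Set.range fun v : U =>
        ((1 / 2) * ‖v‖ ^ 2 + (1 / (2 * β.1)) * ‖L v + z‖ ^ 2)) := by
      refine ⟨0, ?_⟩
      rintro _ ⟨v, rfl⟩
      have := β.2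
      positivity
    have h := ciInf_le hb w
    simpa [hw] using h
  refine ⟨hbdd, fun β hβ => ?_⟩
  have h1 := le_ciSup hbdd ⟨β, hβ⟩
  have h2 := (le_ciInf (hmin β hβ)).trans h1
  set S := ⨆ β' : {β : ℝ // 0 < β},
          ⨅ v : U, ((1 / 2) * ‖v‖ ^ 2 + (1 / (2 * β'.1)) * ‖L v + z‖ ^ 2) with hS
  have h3 : 0 ≤ (1 / (2 * β)) * ‖L (u β) + z‖ ^ 2 := by positivity
  constructor
  · apply Real.le_sqrt_of_sq_le
    linarith
  · apply Real.le_sqrt_of_sq_le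
    have h4 : (1 / (2 * β)) * ‖L (u β) + z‖ ^ 2 ≤ S := by
      have : 0 ≤ (1 / 2) * ‖u β‖ ^ 2 := by positivity
      linarith
    have h5 : ‖L (u β) + z‖ ^ 2 = (1 / (2 * β)) * ‖L (u β) + z‖ ^ 2 * (2 * β) := by
      field_simp
    rw [h5]
    nlinarith
end

section
/- If E := 2·sup_{β>0} inf_{u∈U} F_β(u) is finite, then there exists u ∈ U with L u + z = 0 and ‖u‖_U ≤ √E; that is, finiteness of the optimal penalized energies uniformly in β implies null controllability. -/
open Filter Topology

/-- if `E := 2 sup_{β>0} inf_{u∈U} F_β(u)` is finite (the family of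
infima is bounded above), then there exists `u` with `L u + z = 0` and
`‖u‖ ≤ √E`: finiteness of the optimal penalized energies uniformly in `β`
implies null controllability. -/
theorem stmt3
    {U H : Type*} [NormedAddCommGroup U] [InnerProductSpace ℝ U] [CompleteSpace U]
    [NormedAddCommGroup H] [InnerProductSpace ℝ H] [CompleteSpace H]
    (L : U →L[ℝ] H) (z : H)
    (hE : BddAbove (Set.range fun β : {β : ℝ // 0 < β} =>
      ⨅ v : U, ((1 / 2) * ‖v‖ ^ 2 + (1 / (2 * β.1)) * ‖L v + z‖ ^ 2))) :
    ∃ u : U, L u + z = 0 ∧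
      ‖u‖ ≤ Real.sqrt (2 * ⨆ β : {β : ℝ // 0 < β},
        ⨅ v : U, ((1 / 2) * ‖v‖ ^ 2 + (1 / (2 * β.1)) * ‖L v + z‖ ^ 2)) := by
  classical
  set S := ⨆ β : {β : ℝ // 0 < β},
        ⨅ v : U, ((1 / 2) * ‖v‖ ^ 2 + (1 / (2 * β.1)) * ‖L v + z‖ ^ 2) with hS
  let b : ℕ → ℝ := fun n => 1 / ((n : ℝ) + 1)
  have hb : ∀ n, 0 < b n := fun n => by positivity
  have hb1 : ∀ n k, n ≤ k → b k ≤ b n := fun n k h => one_div_le_one_div_of_le (by positivity)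
    (by have : (n : ℝ) ≤ k := by exact_mod_cast h
        linarith)
  have hb0 : Tendsto b atTop (𝓝 0) := tendsto_one_div_add_atTop_nhds_zero_nat
  let F : ℕ → U → ℝ := fun n v => (1 / 2) * ‖v‖ ^ 2 + (1 / (2 * b n)) * ‖L v + z‖ ^ 2
  have hF0 : ∀ n v, 0 ≤ F n v := fun n v => by
    have := hb n
    positivity
  have hFb : ∀ n, BddBelow (Set.range (F n)) := fun n =>
    ⟨0, by rintro _ ⟨v, rfl⟩; exact hF0 n v⟩
  let m : ℕ → ℝ := fun n => ⨅ v, F n v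
  have hmF : ∀ n v, m n ≤ F n v := fun n v => ciInf_le (hFb n) v
  have hmS : ∀ n, m n ≤ S := fun n => le_ciSup hE ⟨b n, hb n⟩
  have hFmono : ∀ n k v, n ≤ k → F n v ≤ F k v := fun n k v h => by
    have h1 : 1 / (2 * b n) ≤ 1 / (2 * b k) :=
      one_div_le_one_div_of_le (by have := hb k; positivity) (by linarith [hb1 n k h])
    have h2 := mul_le_mul_of_nonneg_right h1 (sq_nonneg ‖L v + z‖)
    simp only [F]
    linarith
  have hmm : Monotone m := fun n k h => ciInf_mono (hFb n) fun v => hFmono n k v h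
  have hmB : BddAbove (Set.range m) := ⟨S, by rintro _ ⟨n, rfl⟩; exact hmS n⟩
  have hlim := tendsto_atTop_ciSup hmm hmB
  set S' := ⨆ n, m n with hS'
  have hmS' : ∀ n, m n ≤ S' := fun n => le_ciSup hmB n
  have hS'S : S' ≤ S := ciSup_le hmS
  have hex : ∀ n, ∃ v, F n v < m n + b n := fun n =>
    exists_lt_of_ciInf_lt (by have := hb n; change m n < _; linarith)
  choose u hu using hex
  have key : ∀ n k N, N ≤ n → N ≤ k → ‖u n - u k‖ ^ 2 ≤ 8 * (S' + b N - m N) := by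
    intro n k N hn hk
    have e1 : F N (u n) ≤ S' + b N := by
      linarith [hFmono N n (u n) hn, hu n, hmS' n, hb1 N n hn]
    have e2 : F N (u k) ≤ S' + b N := by
      linarith [hFmono N k (u k) hk, hu k, hmS' k, hb1 N k hk]
    have e3 := hmF N ((1 / 2 : ℝ) • (u n + u k))
    have p1 := parallelogram_law_with_norm ℝ (u n) (u k)
    have p2 := parallelogram_law_with_norm ℝ (L (u n) + z) (L (u k) + z)
    have q1 : ‖(1 / 2 : ℝ) • (u n + u k)‖ = 1 / 2 * ‖u n + u k‖ := by
      rw [norm_smul]; norm_num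
    have q2 : ‖L ((1 / 2 : ℝ) • (u n + u k)) + z‖
        = 1 / 2 * ‖(L (u n) + z) + (L (u k) + z)‖ := by
      have : L ((1 / 2 : ℝ) • (u n + u k)) + z
          = (1 / 2 : ℝ) • ((L (u n) + z) + (L (u k) + z)) := by
        rw [map_smul, map_add]; module
      rw [this, norm_smul]; norm_num
    simp only [F] at e1 e2 e3
    rw [q1, q2] at e3
    have hc : 0 < 1 / (2 * b N) := by have := hb N; positivity
    generalize 1 / (2 * b N) = c at *
    have q3 : ‖(L (u n) + z) + (L (u k) + z)‖ ^ 2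
        ≤ 2 * (‖L (u n) + z‖ ^ 2 + ‖L (u k) + z‖ ^ 2) := by
      nlinarith [sq_nonneg ‖(L (u n) + z) - (L (u k) + z)‖]
    have q4 := mul_le_mul_of_nonneg_left q3 hc.le
    nlinarith
  have hcau : CauchySeq u := by
    refine cauchySeq_of_le_tendsto_0 (fun N => √(8 * (S' + b N - m N))) ?_ ?_
    · intro n k N hn hk
      rw [dist_eq_norm]
      exact Real.le_sqrt_of_sq_le (key n k N hn hk)
    · have h1 : Tendsto (fun N => 8 * (S' + b N - m N)) atTop (𝓝 (8 * (S' + 0 - S'))) :=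
        ((hb0.const_add S').sub hlim).const_mul 8
      have h2 := h1.sqrt
      simpa using h2
  obtain ⟨w, hw⟩ := cauchySeq_tendsto_of_complete hcau
  have hLw : Tendsto (fun n => ‖L (u n) + z‖ ^ 2) atTop (𝓝 (‖L w + z‖ ^ 2)) :=
    ((((L.continuous.tendsto w).comp hw).add_const z).norm).pow 2
  refine ⟨w, ?_, ?_⟩
  · have h0 : ∀ n, ‖L (u n) + z‖ ^ 2 ≤ 2 * b n * (S + b n) := fun n => by
      have h1 : (1 / (2 * b n)) * ‖L (u n) + z‖ ^ 2 ≤ S + b n := by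
        have := hu n
        simp only [F] at this
        nlinarith [hmS n, sq_nonneg ‖u n‖]
      have h2 := hb n
      have h3 := mul_le_mul_of_nonneg_left h1 (by positivity : 0 ≤ 2 * b n)
      have h4 : 2 * b n * (1 / (2 * b n) * ‖L (u n) + z‖ ^ 2) = ‖L (u n) + z‖ ^ 2 := by
        field_simp
      linarith
    have h1 : Tendsto (fun n => 2 * b n * (S + b n)) atTop (𝓝 (2 * 0 * (S + 0))) :=
      (hb0.const_mul 2).mul (hb0.const_add S)
    have h2 := le_of_tendsto_of_tendsto' hLw h1 h0
    have h3 : ‖L w + z‖ = 0 := by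
      have : ‖L w + z‖ ^ 2 = 0 := le_antisymm (by simpa using h2) (sq_nonneg _)
      exact pow_eq_zero_iff (two_ne_zero) |>.1 this
    exact norm_eq_zero.1 h3
  · apply Real.le_sqrt_of_sq_le
    have h0 : ∀ n, ‖u n‖ ^ 2 ≤ 2 * (S + b n) := fun n => by
      have h1 := hu n
      have h2 : 0 ≤ (1 / (2 * b n)) * ‖L (u n) + z‖ ^ 2 := by
        have := hb n
        positivity
      simp only [F] at h1
      linarith [hmS n]
    have h1 : Tendsto (fun n => 2 * (S + b n)) atTop (𝓝 (2 * (S + 0))) :=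
      (hb0.const_add S).const_mul 2
    have h2 := le_of_tendsto_of_tendsto' (hw.norm.pow 2) h1 h0
    simpa using h2
end

section
/- Assume the set S := {u ∈ U : L u + z = 0} is nonempty. Then S is a nonempty closed convex (affine) subset of U, hence contains a unique element ū of minimal norm, and the minimizers u_β of F_β converge strongly in U to ū as β → 0⁺. -/
open Filter Topology

/-- if `S = {u : L u + z = 0}` is nonempty, then `S` is closed and
convex, contains a unique element `ubar` of minimal norm, and the minimizers
`u_β` of the penalized HUM functionals converge strongly to `ubar` as `β → 0⁺`. -/
theorem stmt4
    {U H : Type*} [NormedAddCommGroup U] [InnerProductSpace ℝ U] [CompleteSpace U]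
    [NormedAddCommGroup H] [InnerProductSpace ℝ H] [CompleteSpace H]
    (L : U →L[ℝ] H) (z : H) (u : ℝ → U)
    (hmin : ∀ β : ℝ, 0 < β → ∀ v : U,
      (1 / 2) * ‖u β‖ ^ 2 + (1 / (2 * β)) * ‖L (u β) + z‖ ^ 2 ≤
        (1 / 2) * ‖v‖ ^ 2 + (1 / (2 * β)) * ‖L v + z‖ ^ 2)
    (hS : {w : U | L w + z = 0}.Nonempty) :
    IsClosed {w : U | L w + z = 0} ∧ Convex ℝ {w : U | L w + z = 0} ∧
    ∃ ubar ∈ {w : U | L w + z = 0},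
      (∀ v ∈ {w : U | L w + z = 0}, ‖ubar‖ ≤ ‖v‖) ∧
      (∀ w' ∈ {w : U | L w + z = 0}, (∀ v ∈ {w : U | L w + z = 0}, ‖w'‖ ≤ ‖v‖) → w' = ubar) ∧
      Tendsto u (𝓝[>] (0 : ℝ)) (𝓝 ubar) := by
  refine ⟨isClosed_eq (by fun_prop) continuous_const, ?_, ?_⟩
  · intro x hx y hy a b _ _ hab
    simp only [Set.mem_setOf_eq] at *
    have h1 : L (a • x + b • y) + z = a • (L x + z) + b • (L y + z) := by
      have : z = a • z + b • z := by rw [← add_smul, hab, one_smul]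
      rw [map_add, map_smul, map_smul, smul_add, smul_add]
      nth_rewrite 1 [this]
      abel
    rw [h1, hx, hy, smul_zero, smul_zero, add_zero]
  obtain ⟨w, hw⟩ := hS
  simp only [Set.mem_setOf_eq] at hw ⊢
  haveI : CompleteSpace L.ker := L.isClosed_ker.completeSpace_coe
  obtain ⟨k, hk, b, hb, hwkb⟩ := L.ker.exists_add_mem_mem_orthogonal w
  have hLk : L k = 0 := hk
  have hLb : L b + z = 0 := by
    rw [← hw, hwkb, map_add, hLk, zero_add]
  have hperp : ∀ x : U, L x = 0 → inner ℝ b x = 0 := fun x hx =>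
    (Submodule.mem_orthogonal' _ _).1 hb x hx
  have hexp : ∀ v : U, ‖v‖ ^ 2 = ‖b‖ ^ 2 + 2 * inner ℝ b (v - b) + ‖v - b‖ ^ 2 := by
    intro v
    rw [← norm_add_sq_real, add_sub_cancel]
  have hpyth : ∀ v : U, L v + z = 0 → ‖v‖ ^ 2 = ‖b‖ ^ 2 + ‖v - b‖ ^ 2 := by
    intro v hv
    have : L (v - b) = 0 := by
      rw [map_sub, sub_eq_zero]; exact add_right_cancel (hv.trans hLb.symm)
    rw [hexp v, hperp _ this]; ring
  refine ⟨b, hLb, ?_, ?_, ?_⟩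
  · intro v hv
    refine le_of_sq_le_sq ?_ (norm_nonneg _)
    nlinarith [hpyth v hv, sq_nonneg ‖v - b‖]
  · intro v hv hvm
    have h1 := hvm b hLb
    have h2 := hpyth v hv
    have h3 : ‖v - b‖ ^ 2 ≤ 0 := by nlinarith [norm_nonneg v, norm_nonneg b]
    have h4 : ‖v - b‖ = 0 := by
      have := sq_nonneg ‖v - b‖
      exact pow_eq_zero_iff (two_ne_zero) |>.1 (le_antisymm h3 this)
    exact sub_eq_zero.1 (norm_eq_zero.1 h4)
  have key : ∀ β : ℝ, 0 < β → ∀ h : H,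
      ‖u β - b‖ ^ 2 ≤ 4 * ‖b - L.adjoint h‖ * ‖b‖ + β * ‖h‖ ^ 2 := by
    intro β hβ h
    have h1 := hmin β hβ b
    rw [hLb, norm_zero] at h1
    have hz : L (u β) + z = L (u β - b) := by
      rw [map_sub, eq_neg_of_add_eq_zero_left hLb]; abel
    rw [hz] at h1
    set r := ‖L (u β - b)‖ with hr
    have h2 := hexp (u β)
    have h3 : inner ℝ b (u β - b) = inner ℝ (b - L.adjoint h) (u β - b)
        + inner ℝ h (L (u β - b)) := by
      rw [inner_sub_left, ContinuousLinearMap.adjoint_inner_left]; ring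
    have h4 := neg_le_of_abs_le (abs_real_inner_le_norm (b - L.adjoint h) (u β - b))
    have h5 := neg_le_of_abs_le (abs_real_inner_le_norm h (L (u β - b)))
    rw [← hr] at h5
    have hq : 1 / (2 * β) * r ^ 2 = (r ^ 2 / β) / 2 := by field_simp
    have hq0 : 0 ≤ r ^ 2 / β := by positivity
    have h6 : ‖u β‖ ≤ ‖b‖ := by
      refine le_of_sq_le_sq ?_ (norm_nonneg _)
      rw [hq] at h1; linarith
    have h7 : ‖u β - b‖ ≤ 2 * ‖b‖ := (norm_sub_le _ _).trans (by linarith)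
    have h8 := mul_le_mul_of_nonneg_left h7 (norm_nonneg (b - L.adjoint h))
    have h9 : 2 * (‖h‖ * r) ≤ r ^ 2 / β + β * ‖h‖ ^ 2 := by
      have : r ^ 2 / β + β * ‖h‖ ^ 2 - 2 * (‖h‖ * r) = (r - β * ‖h‖) ^ 2 / β := by
        field_simp; ring
      have : 0 ≤ (r - β * ‖h‖) ^ 2 / β := by positivity
      linarith
    rw [hq] at h1
    linarith
  have hcl : b ∈ closure (Set.range L.adjoint) := by
    have := hb
    rw [ContinuousLinearMap.orthogonal_ker] at this
    exact this
  rw [Metric.tendsto_nhds]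
  intro ε hε
  have hδ : 0 < ε ^ 2 / (8 * (‖b‖ + 1)) := by positivity
  obtain ⟨_, ⟨h, rfl⟩, hh⟩ := Metric.mem_closure_iff.1 hcl _ hδ
  rw [dist_eq_norm] at hh
  have hβ : 0 < ε ^ 2 / (2 * (‖h‖ ^ 2 + 1)) := by positivity
  filter_upwards [Ioo_mem_nhdsGT hβ] with β hb2
  have hk2 := key β hb2.1 h
  rw [dist_eq_norm]
  refine lt_of_pow_lt_pow_left₀ 2 hε.le (hk2.trans_lt ?_)
  have e1 := (lt_div_iff₀ (by positivity)).1 hh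
  have e2 := (lt_div_iff₀ (by positivity)).1 hb2.2
  nlinarith [norm_nonneg (b - L.adjoint h), hb2.1]
end

section
/- Let s ∈ (0,1), γ_s := 2^{−2s}·√π/(Γ((1+2s)/2)·Γ(1+s)), and define u : ℝ → ℝ by u(y) := γ_s·(1−y²)^s for |y| < 1 and u(y) := 0 for |y| ≥ 1. Then for every x ∈ (−1,1), the principal-value limit defining (−Δ)^s u(x) converges and (−Δ)^s u(x) = 1. -/
open MeasureTheory Filter Topology

lemma aux_beta (s : ℝ) (h0 : 0 < s) (h1 : s < 1) :
    IntervalIntegrable (fun t : ℝ => t ^ (s - 1) * (1 - t) ^ (-s)) volume 0 1 ∧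
    ∫ t in (0:ℝ)..1, t ^ (s - 1) * (1 - t) ^ (-s) = Real.Gamma s * Real.Gamma (1 - s) := by
  have hcv := Complex.betaIntegral_convergent (u := (s:ℂ)) (v := ((1 - s : ℝ):ℂ))
    (by simpa using h0) (by simp; linarith)
  have heq : ∀ t ∈ Set.uIcc (0:ℝ) 1, ((t : ℂ) ^ ((s:ℂ) - 1) * (1 - (t : ℂ)) ^ (((1 - s : ℝ):ℂ) - 1))
      = ((t ^ (s - 1) * (1 - t) ^ (-s) : ℝ) : ℂ) := by
    intro t ht
    rw [Set.uIcc_of_le zero_le_one] at ht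
    push_cast
    rw [Complex.ofReal_cpow ht.1, Complex.ofReal_cpow (by linarith [ht.2])]
    push_cast
    congr 2
    ring
  constructor
  · have h2 := hcv.1.re
    rw [intervalIntegrable_iff_integrableOn_Ioc_of_le zero_le_one]
    refine (IntegrableOn.congr_fun h2 ?_ measurableSet_Ioc)
    intro t ht
    have := heq t (by rw [Set.uIcc_of_le zero_le_one]; exact ⟨ht.1.le, ht.2⟩)
    simp only [this]
    simp
  · have hB := Complex.Gamma_mul_Gamma_eq_betaIntegral (s := (s:ℂ)) (t := ((1 - s : ℝ):ℂ))
      (by simpa using h0) (by simp; linarith)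
    rw [Complex.betaIntegral, intervalIntegral.integral_congr heq, intervalIntegral.integral_ofReal] at hB
    rw [Complex.Gamma_ofReal, Complex.Gamma_ofReal, ← Complex.ofReal_add] at hB
    simp at hB
    exact_mod_cast hB.symm

lemma aux_pow (s : ℝ) (h0 : 0 < s) (h1 : s < 1) (m a b : ℝ) (hm : 0 < m) (ha : m ≤ a) (hb : m ≤ b) :
    |a ^ s - b ^ s| ≤ m ^ (s - 1) * |a - b| := by
  have := Convex.norm_image_sub_le_of_norm_hasDerivWithin_le (f := fun t : ℝ => t ^ s)
    (f' := fun t => s * t ^ (s - 1)) (s := Set.Ici m) (C := m ^ (s - 1)) (x := b) (y := a)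
    (fun t ht => (Real.hasDerivAt_rpow_const (Or.inl (hm.trans_le ht).ne')).hasDerivWithinAt) ?_
    (convex_Ici m) hb ha
  · simpa using this
  · intro t ht
    have htp : 0 < t := hm.trans_le ht
    rw [Real.norm_of_nonneg (by positivity)]
    have : t ^ (s - 1) ≤ m ^ (s - 1) := Real.rpow_le_rpow_of_nonpos hm ht (by linarith)
    have h3 : 0 ≤ t ^ (s-1) := by positivity
    nlinarith

lemma aux_q (s : ℝ) (h0 : 0 < s) (h1 : s < 1) (x R : ℝ) (hx : x ^ 2 < 1) (hR : 1 < R) :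
    (∫ q in (1:ℝ)..R, 2 * q * (q ^ 2 - 1) ^ s / (q ^ 2 - x ^ 2)) =
      (R ^ 2 - 1) ^ s / s - (1 - x ^ 2) ^ s *
        ∫ t in (0:ℝ)..((R ^ 2 - 1) / (R ^ 2 - x ^ 2)), t ^ (s - 1) * (1 - t) ^ (-s) := by
  have hu : Set.uIcc 1 R = Set.Icc 1 R := Set.uIcc_of_le hR.le
  have e1 : (∫ q in (1:ℝ)..R, (q ^ 2 - 1) ^ (s - 1) * (2 * q)) = (R ^ 2 - 1) ^ s / s ∧
      IntervalIntegrable (fun q : ℝ => (q ^ 2 - 1) ^ (s - 1) * (2 * q)) volume 1 R := by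
    have hc : ContinuousOn (fun q : ℝ => q ^ 2 - 1) (Set.uIcc 1 R) := by fun_prop
    have hd : ∀ q ∈ Set.Ioo (min 1 R) (max 1 R), HasDerivAt (fun q : ℝ => q ^ 2 - 1) (2 * q) q := by
      intro q _
      simpa using ((hasDerivAt_id q).pow 2).sub_const 1
    have hn : ∀ q ∈ Set.Ioo (min 1 R) (max 1 R), 0 ≤ 2 * q := by
      intro q hq
      rw [min_eq_left hR.le] at hq
      linarith [hq.1]
    constructor
    · have := intervalIntegral.integral_comp_mul_deriv_of_deriv_nonneg
        (g := fun v : ℝ => v ^ (s - 1)) hc hd hn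
      simp only [Function.comp_def] at this
      rw [this, integral_rpow (Or.inl (by linarith))]
      simp [h0.ne']
    · have := intervalIntegral.integrable_comp_mul_deriv_iff_of_deriv_nonneg
        (g := fun v : ℝ => v ^ (s - 1)) hc hd hn
      simp only [Function.comp_def] at this
      rw [this]
      exact intervalIntegral.intervalIntegrable_rpow' (by linarith)
  have i2 : IntervalIntegrable (fun q : ℝ => 2 * q * (q ^ 2 - 1) ^ s / (q ^ 2 - x ^ 2)) volume 1 R := by
    apply ContinuousOn.intervalIntegrable
    rw [hu]
    apply ContinuousOn.div
    · exact (by fun_prop : ContinuousOn (fun q : ℝ => 2 * q) _).mul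
        ((by fun_prop : ContinuousOn (fun q : ℝ => q ^ 2 - 1) _).rpow_const (fun _ _ => Or.inr h0.le))
    · fun_prop
    · intro q hq
      have := hq.1
      nlinarith
  have e3 := intervalIntegral.integral_comp_mul_deriv_of_deriv_nonneg (a := 1) (b := R)
    (f := fun q : ℝ => (q ^ 2 - 1) / (q ^ 2 - x ^ 2))
    (f' := fun q : ℝ => 2 * q * (1 - x ^ 2) / (q ^ 2 - x ^ 2) ^ 2)
    (g := fun t : ℝ => t ^ (s - 1) * (1 - t) ^ (-s)) ?_ ?_ ?_
  · simp only [Function.comp_def] at e3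
    have hz : ((1:ℝ) ^ 2 - 1) / (1 ^ 2 - x ^ 2) = 0 := by simp
    rw [hz] at e3
    rw [← e3, ← e1.1, ← intervalIntegral.integral_const_mul, eq_sub_iff_add_eq', ← eq_sub_iff_add_eq,
      ← intervalIntegral.integral_sub e1.2 i2]
    rw [intervalIntegral.integral_of_le hR.le, intervalIntegral.integral_of_le hR.le]
    apply setIntegral_congr_fun measurableSet_Ioc
    intro q hq
    have hq1 : 1 < q := hq.1
    have hp : 0 < q ^ 2 - 1 := by nlinarith
    have hp2 : 0 < q ^ 2 - x ^ 2 := by nlinarith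
    have hA : 0 < 1 - x ^ 2 := by linarith
    simp only
    have e : 1 - (q ^ 2 - 1) / (q ^ 2 - x ^ 2) = (1 - x ^ 2) / (q ^ 2 - x ^ 2) := by
      field_simp; ring
    rw [e, Real.div_rpow hp.le hp2.le, Real.div_rpow hA.le hp2.le, Real.rpow_neg hA.le,
      Real.rpow_neg hp2.le, Real.rpow_sub_one hp.ne', Real.rpow_sub_one hp2.ne']
    have a1 : 0 < (q ^ 2 - x ^ 2) ^ s := by positivity
    have a2 : 0 < (1 - x ^ 2) ^ s := by positivity
    field_simp
    ring
  · rw [hu]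
    apply ContinuousOn.div (by fun_prop) (by fun_prop)
    intro q hq
    have := hq.1
    nlinarith
  · intro q hq
    rw [min_eq_left hR.le] at hq
    have hq1 : 1 < q := hq.1
    have hp2 : q ^ 2 - x ^ 2 ≠ 0 := by nlinarith
    have h := (((hasDerivAt_id q).pow 2).sub_const 1).div (((hasDerivAt_id q).pow 2).sub_const (x ^ 2)) hp2
    convert! h using 1
    simp
    ring
  · intro q hq
    rw [min_eq_left hR.le] at hq
    have hq1 : 1 < q := hq.1
    have hA : 0 < 1 - x ^ 2 := by linarith
    positivity

lemma aux_shift (s : ℝ) (h0 : 0 < s) (h1 : s < 1) (x R r : ℝ) (hx : |x| ≤ 1) (hr : |r| ≤ 1)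
    (hR : 4 ≤ R) :
    |((R + r) ^ 2 - 1) ^ s / (R + r - x) - ((R - r) ^ 2 - 1) ^ s / (R - r + x)| ≤
      72 * (R ^ 2 / 4) ^ (s - 1) := by
  obtain ⟨hx1, hx2⟩ := abs_le.1 hx
  obtain ⟨hr1, hr2⟩ := abs_le.1 hr
  set m := R ^ 2 / 4 with hm
  have hmp : 0 < m := by positivity
  have ha : m ≤ (R + r) ^ 2 - 1 := by nlinarith
  have hb : m ≤ (R - r) ^ 2 - 1 := by nlinarith
  have hb2 : (R - r) ^ 2 - 1 ≤ 4 * R ^ 2 := by nlinarith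
  have hM := aux_pow s h0 h1 m _ _ hmp ha hb
  set a := (R + r) ^ 2 - 1 with hadef
  set b := (R - r) ^ 2 - 1 with hbdef
  set M := m ^ (s - 1) with hMdef
  have hMp : 0 < M := by positivity
  have hab : |a - b| ≤ 4 * R := by
    rw [abs_le]; constructor <;> nlinarith
  have hbp : 0 < b := by linarith
  have hbs : b ^ s ≤ 4 * R ^ 2 * M := by
    have : b ^ s = b * b ^ (s - 1) := by
      rw [Real.rpow_sub_one hbp.ne']; field_simp
    rw [this]
    have h2 : b ^ (s - 1) ≤ M := Real.rpow_le_rpow_of_nonpos hmp hb (by linarith)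
    have h3 : 0 < b ^ (s-1) := by positivity
    gcongr
  have hp : R / 2 ≤ R + r - x := by linarith
  have hp' : R / 2 ≤ R - r + x := by linarith
  have hpp : 0 < R + r - x := by linarith
  have hpp' : 0 < R - r + x := by linarith
  have hRp : 0 < R := by linarith
  have key : a ^ s / (R + r - x) - b ^ s / (R - r + x) =
      (a ^ s - b ^ s) / (R + r - x) + b ^ s * (2 * (x - r)) / ((R + r - x) * (R - r + x)) := by
    field_simp; ring
  rw [key]
  have t1 : |(a ^ s - b ^ s) / (R + r - x)| ≤ 8 * M := by
    rw [abs_div, abs_of_pos hpp, div_le_iff₀ hpp]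
    calc _ ≤ M * |a - b| := hM
      _ ≤ M * (4 * R) := by gcongr
      _ ≤ 8 * M * (R + r - x) := by nlinarith
  have t2 : |b ^ s * (2 * (x - r)) / ((R + r - x) * (R - r + x))| ≤ 64 * M := by
    rw [abs_div, abs_of_pos (mul_pos hpp hpp'), div_le_iff₀ (mul_pos hpp hpp'), abs_mul,
      abs_of_pos (by positivity : 0 < b ^ s)]
    have : |2 * (x - r)| ≤ 4 := by rw [abs_le]; constructor <;> linarith
    calc _ ≤ 4 * R ^ 2 * M * 4 := by gcongr
      _ = 64 * M * ((R / 2) * (R / 2)) := by ring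
      _ ≤ _ := by gcongr
  calc _ ≤ _ := abs_add_le _ _
    _ ≤ 8 * M + 64 * M := add_le_add t1 t2
    _ = _ := by ring

lemma aux_hint (s : ℝ) (h0 : 0 < s) (x a b : ℝ) (hx : |x| < 1) (ha : 1 ≤ a) (hb : 1 ≤ b) :
    IntervalIntegrable (fun q : ℝ => (q ^ 2 - 1) ^ s / (q - x)) volume a b := by
  apply ContinuousOn.intervalIntegrable
  apply ContinuousOn.div
  · exact ((by fun_prop : ContinuousOn (fun q : ℝ => q ^ 2 - 1) _).rpow_const (fun _ _ => Or.inr h0.le))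
  · fun_prop
  · intro q hq
    have h1 : 1 ≤ q := le_trans (le_min ha hb) hq.1
    have := (abs_lt.1 hx).2
    linarith

lemma aux_lim (s : ℝ) (h0 : 0 < s) (h1 : s < 1) (x : ℝ) (hx : |x| < 1) :
    Tendsto (fun R : ℝ => R ^ (2 * s) / s - (∫ q in (1:ℝ)..(R + x), (q ^ 2 - 1) ^ s / (q - x))
      - ∫ q in (1:ℝ)..(R - x), (q ^ 2 - 1) ^ s / (q + x)) atTop
      (𝓝 ((1 - x ^ 2) ^ s * (Real.Gamma s * Real.Gamma (1 - s)))) := by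
  obtain ⟨hx1, hx2⟩ := abs_lt.1 hx
  have hxs : x ^ 2 < 1 := by nlinarith
  have hnx : |-x| < 1 := by rwa [abs_neg]
  obtain ⟨bi, be⟩ := aux_beta s h0 h1
  -- main term
  have hT : Tendsto (fun R : ℝ => (R ^ 2 - 1) / (R ^ 2 - x ^ 2)) atTop (𝓝[Set.uIcc 0 1] 1) := by
    rw [tendsto_nhdsWithin_iff]
    constructor
    · have hz : Tendsto (fun R : ℝ => (1 - x ^ 2) / (R ^ 2 - x ^ 2)) atTop (𝓝 0) :=
        Tendsto.div_atTop tendsto_const_nhds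
          (tendsto_atTop_add_const_right _ _ (tendsto_pow_atTop two_ne_zero))
      have := (tendsto_const_nhds (x := (1:ℝ))).sub hz
      rw [sub_zero] at this
      refine this.congr' ?_
      filter_upwards [eventually_gt_atTop 1] with R hR
      have : R ^ 2 - x ^ 2 ≠ 0 := by nlinarith
      field_simp
      ring
    · filter_upwards [eventually_gt_atTop 1] with R hR
      have : 0 < R ^ 2 - x ^ 2 := by nlinarith
      rw [Set.uIcc_of_le zero_le_one]
      constructor
      · apply div_nonneg <;> nlinarith
      · rw [div_le_one this]; nlinarith
  have hmain : Tendsto (fun R : ℝ => (1 - x ^ 2) ^ s *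
        ∫ t in (0:ℝ)..((R ^ 2 - 1) / (R ^ 2 - x ^ 2)), t ^ (s - 1) * (1 - t) ^ (-s)) atTop
      (𝓝 ((1 - x ^ 2) ^ s * (Real.Gamma s * Real.Gamma (1 - s)))) := by
    rw [← be]
    have hc := intervalIntegral.continuousOn_primitive_interval' bi Set.left_mem_uIcc
    exact ((hc 1 Set.right_mem_uIcc).tendsto.comp hT).const_mul _
  have hMlim : Tendsto (fun R : ℝ => (R ^ 2 / 4) ^ (s - 1)) atTop (𝓝 0) := by
    have := tendsto_rpow_neg_atTop (y := 1 - s) (by linarith)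
    simp only [neg_sub] at this
    exact this.comp ((tendsto_pow_atTop two_ne_zero).atTop_div_const (by norm_num))
  have hrem : Tendsto (fun R : ℝ => (R ^ (2 * s) / s - (∫ q in (1:ℝ)..(R + x), (q ^ 2 - 1) ^ s / (q - x))
      - ∫ q in (1:ℝ)..(R - x), (q ^ 2 - 1) ^ s / (q + x)) - (1 - x ^ 2) ^ s *
        ∫ t in (0:ℝ)..((R ^ 2 - 1) / (R ^ 2 - x ^ 2)), t ^ (s - 1) * (1 - t) ^ (-s)) atTop (𝓝 0) := by
    have hb : Tendsto (fun R : ℝ => (72 + 1 / s) * (R ^ 2 / 4) ^ (s - 1)) atTop (𝓝 0) := by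
      simpa using hMlim.const_mul (72 + 1 / s)
    refine squeeze_zero_norm' ?_ hb
    filter_upwards [eventually_ge_atTop 4] with R hR
    have hq := aux_q s h0 h1 x R hxs (by linarith)
    have ha1 := intervalIntegral.integral_add_adjacent_intervals
      (aux_hint s h0 x 1 R hx le_rfl (by linarith)) (aux_hint s h0 x R (R + x) hx (by linarith) (by linarith))
    have ha2 := intervalIntegral.integral_add_adjacent_intervals
      (aux_hint s h0 (-x) 1 (R - x) hnx le_rfl (by linarith))
      (aux_hint s h0 (-x) (R - x) R hnx (by linarith) (by linarith))
    have hs1 : (∫ q in (1:ℝ)..R, (q ^ 2 - 1) ^ s / (q - x)) + (∫ q in (1:ℝ)..R, (q ^ 2 - 1) ^ s / (q - -x))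
        = ∫ q in (1:ℝ)..R, 2 * q * (q ^ 2 - 1) ^ s / (q ^ 2 - x ^ 2) := by
      rw [← intervalIntegral.integral_add (aux_hint s h0 x 1 R hx le_rfl (by linarith))
        (aux_hint s h0 (-x) 1 R hnx le_rfl (by linarith))]
      apply intervalIntegral.integral_congr
      intro q hq
      rw [Set.uIcc_of_le (by linarith)] at hq
      have h1q : 1 ≤ q := hq.1
      have p1 : q - x ≠ 0 := by linarith
      have p2 : q + x ≠ 0 := by linarith
      have p3 : q ^ 2 - x ^ 2 ≠ 0 := by nlinarith
      simp only [sub_neg_eq_add]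
      rw [show q ^ 2 - x ^ 2 = (q - x) * (q + x) by ring]
      field_simp
      ring
    have sh1 : (∫ q in R..(R + x), (q ^ 2 - 1) ^ s / (q - x)) =
        ∫ r in (0:ℝ)..x, ((R + r) ^ 2 - 1) ^ s / (R + r - x) := by
      have := intervalIntegral.integral_comp_add_left (a := 0) (b := x)
        (fun q : ℝ => (q ^ 2 - 1) ^ s / (q - x)) R
      simpa using this.symm
    have sh2 : (∫ q in (R - x)..R, (q ^ 2 - 1) ^ s / (q - -x)) =
        ∫ r in (0:ℝ)..x, ((R - r) ^ 2 - 1) ^ s / (R - r + x) := by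
      have := intervalIntegral.integral_comp_sub_left (a := 0) (b := x)
        (fun q : ℝ => (q ^ 2 - 1) ^ s / (q - -x)) R
      simpa using this.symm
    have i1 : IntervalIntegrable (fun r : ℝ => ((R + r) ^ 2 - 1) ^ s / (R + r - x)) volume 0 x := by
      have := (aux_hint s h0 x R (R + x) hx (by linarith) (by linarith)).comp_add_left R
      simpa using this
    have i2 : IntervalIntegrable (fun r : ℝ => ((R - r) ^ 2 - 1) ^ s / (R - r + x)) volume 0 x := by
      have := (aux_hint s h0 (-x) R (R - x) hnx (by linarith) (by linarith)).comp_sub_left R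
      simpa using this
    have hsh : |(∫ q in R..(R + x), (q ^ 2 - 1) ^ s / (q - x)) -
        ∫ q in (R - x)..R, (q ^ 2 - 1) ^ s / (q - -x)| ≤ 72 * (R ^ 2 / 4) ^ (s - 1) := by
      rw [sh1, sh2, ← intervalIntegral.integral_sub i1 i2]
      have := intervalIntegral.norm_integral_le_of_norm_le_const (a := 0) (b := x)
        (C := 72 * (R ^ 2 / 4) ^ (s - 1))
        (f := fun r : ℝ => ((R + r) ^ 2 - 1) ^ s / (R + r - x) - ((R - r) ^ 2 - 1) ^ s / (R - r + x))
        (fun r hr => by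
          refine aux_shift s h0 h1 x R r hx.le ?_ hR
          have h5 := Set.uIoc_subset_uIcc hr
          have h6 := Set.abs_sub_left_of_mem_uIcc h5
          simp at h6
          linarith)
      refine this.trans ?_
      have : 0 ≤ 72 * (R ^ 2 / 4) ^ (s - 1) := by positivity
      simp only [sub_zero]
      nlinarith [abs_nonneg x]
    have hpw : |R ^ (2 * s) - (R ^ 2 - 1) ^ s| ≤ (R ^ 2 / 4) ^ (s - 1) := by
      rw [Real.rpow_mul (by linarith), Real.rpow_two]
      have := aux_pow s h0 h1 (R ^ 2 / 4) (R ^ 2) (R ^ 2 - 1) (by positivity) (by nlinarith) (by nlinarith)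
      simpa using this
    simp only [sub_neg_eq_add] at *
    have hfin : (R ^ (2 * s) / s - (∫ q in (1:ℝ)..(R + x), (q ^ 2 - 1) ^ s / (q - x))
      - ∫ q in (1:ℝ)..(R - x), (q ^ 2 - 1) ^ s / (q + x)) - (1 - x ^ 2) ^ s *
        (∫ t in (0:ℝ)..((R ^ 2 - 1) / (R ^ 2 - x ^ 2)), t ^ (s - 1) * (1 - t) ^ (-s)) =
        (R ^ (2 * s) - (R ^ 2 - 1) ^ s) / s - ((∫ q in R..(R + x), (q ^ 2 - 1) ^ s / (q - x)) -
        ∫ q in (R - x)..R, (q ^ 2 - 1) ^ s / (q + x)) := by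
      rw [sub_div (R ^ (2 * s))]
      linarith
    rw [hfin, Real.norm_eq_abs]
    calc _ ≤ _ := abs_sub _ _
      _ ≤ (R ^ 2 / 4) ^ (s - 1) / s + 72 * (R ^ 2 / 4) ^ (s - 1) := by
        refine add_le_add ?_ hsh
        rw [abs_div, abs_of_pos h0]
        gcongr
      _ = _ := by ring
  have := hrem.add hmain
  simpa using this

/-- The truncated profile `(1 - y ^ 2)_+ ^ s`. -/
noncomputable def auxW (s y : ℝ) : ℝ := if |y| < 1 then (1 - y ^ 2) ^ s else 0

lemma auxW_meas (s : ℝ) : Measurable (auxW s) := by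
  unfold auxW
  refine Measurable.ite (measurableSet_lt (by fun_prop) (by fun_prop)) ?_ (by fun_prop)
  fun_prop

lemma auxW_bound (s : ℝ) (h0 : 0 < s) (y : ℝ) : |auxW s y| ≤ 1 := by
  unfold auxW
  split_ifs with h
  · have h2 : 0 ≤ 1 - y ^ 2 := by
      have := (sq_lt_one_iff_abs_lt_one y).2 h
      linarith
    rw [abs_of_nonneg (by positivity)]
    exact Real.rpow_le_one h2 (by nlinarith [sq_nonneg y]) h0.le
  · simp

lemma auxW_neg (s y : ℝ) : auxW s (-y) = auxW s y := by simp [auxW]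

lemma aux_right (s : ℝ) (h0 : 0 < s) (x ε : ℝ) (hx : |x| < 1) (he : 0 < ε)
    (he1 : ε < 1 - x) :
    IntegrableOn (fun y => (auxW s x - auxW s y) / |x - y| ^ (1 + 2 * s)) (Set.Ioi (x + ε)) ∧
    ∫ y in Set.Ioi (x + ε), (auxW s x - auxW s y) / |x - y| ^ (1 + 2 * s) =
      ((1 - x ^ 2) ^ s)⁻¹ * (((1 - x ^ 2) / ε) ^ (2 * s) / (2 * s) -
        ∫ q in (1:ℝ)..((1 - x ^ 2) / ε - x), (q ^ 2 - 1) ^ s / (q + x)) := by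
  obtain ⟨hx1, hx2⟩ := abs_lt.1 hx
  have hxs : x ^ 2 < 1 := by nlinarith
  set A := 1 - x ^ 2 with hA
  have hAp : 0 < A := by linarith
  have hR : 1 + x < A / ε := by
    rw [lt_div_iff₀ he]; nlinarith
  set R := A / ε with hRd
  have hcongr : ∀ y ∈ Set.Ioi (x + ε), auxW s x * (y - x) ^ (-(1 + 2 * s)) -
      auxW s y * (y - x) ^ (-(1 + 2 * s)) = (auxW s x - auxW s y) / |x - y| ^ (1 + 2 * s) := by
    intro y hy
    have hy' : x + ε < y := hy
    rw [abs_sub_comm, abs_of_pos (by linarith), Real.rpow_neg (by linarith)]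
    field_simp
  have hK : IntegrableOn (fun y : ℝ => (y - x) ^ (-(1 + 2 * s))) (Set.Ioi (x + ε)) := by
    have := integrableOn_add_rpow_Ioi_of_lt (a := -(1 + 2 * s)) (c := x + ε) (m := -x)
      (by linarith) (by linarith)
    simpa [sub_eq_add_neg] using this
  have hWK : IntegrableOn (fun y : ℝ => auxW s y * (y - x) ^ (-(1 + 2 * s))) (Set.Ioi (x + ε)) := by
    refine Integrable.bdd_mul (c := 1) hK (auxW_meas s).aestronglyMeasurable ?_
    exact Eventually.of_forall (auxW_bound s h0)
  have hKint : ∫ y in Set.Ioi (x + ε), (y - x) ^ (-(1 + 2 * s)) = ε ^ (-(2 * s)) / (2 * s) := by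
    have := integral_Ioi_of_hasDerivAt_of_tendsto' (a := x + ε)
      (f := fun y : ℝ => - ((y - x) ^ (-(2 * s)) / (2 * s)))
      (f' := fun y : ℝ => (y - x) ^ (-(1 + 2 * s))) (m := 0) ?_ hK ?_
    · rw [this]; simp
    · intro y hy
      have hy' : x + ε ≤ y := hy
      have h := ((((hasDerivAt_id y).sub_const x).rpow_const (p := -(2 * s))
        (Or.inl (by simp; linarith))).div_const (2 * s)).neg
      convert! h using 1
      simp
      rw [show -(2 * s) - 1 = -(2 * s) + -1 by ring]
      field_simp
    · have h := tendsto_rpow_neg_atTop (y := 2 * s) (by linarith)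
      have h2 := (h.comp (tendsto_atTop_add_const_right atTop (-x) tendsto_id)).div_const (2 * s)
      have h3 := h2.neg
      simpa [Function.comp_def, sub_eq_add_neg] using h3
  have hWint : ∫ y in Set.Ioi (x + ε), auxW s y * (y - x) ^ (-(1 + 2 * s)) =
      (A ^ s)⁻¹ * ∫ q in (1:ℝ)..(R - x), (q ^ 2 - 1) ^ s / (q + x) := by
    have e1 : ∫ y in Set.Ioi (x + ε), auxW s y * (y - x) ^ (-(1 + 2 * s)) =
        ∫ y in (x + ε)..1, (1 - y ^ 2) ^ s * (y - x) ^ (-(1 + 2 * s)) := by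
      rw [intervalIntegral.integral_of_le (by linarith)]
      rw [setIntegral_eq_of_subset_of_forall_sdiff_eq_zero (s := Set.Ioc (x + ε) 1) measurableSet_Ioi
        Set.Ioc_subset_Ioi_self]
      · apply setIntegral_congr_fun measurableSet_Ioc
        intro y hy
        simp only [auxW]
        split_ifs with h
        · rfl
        · have hy1 : y = 1 := by
            by_contra hne
            apply h
            rw [abs_lt]
            constructor
            · linarith [hy.1]
            · exact lt_of_le_of_ne hy.2 hne
          rw [hy1]
          simp [Real.zero_rpow h0.ne']
      · intro y hy
        have h1 : x + ε < y := hy.1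
        have h2 : ¬ (x + ε < y ∧ y ≤ 1) := hy.2
        have h3 : 1 < y := by
          by_contra h; exact h2 ⟨h1, not_lt.1 h⟩
        have : ¬ |y| < 1 := by
          intro h; linarith [(abs_lt.1 h).2]
        simp [auxW, this]
    have e2 := intervalIntegral.integral_comp_mul_deriv_of_deriv_nonpos (a := 1) (b := R - x)
      (f := fun q : ℝ => x + A / (q + x)) (f' := fun q : ℝ => - A / (q + x) ^ 2)
      (g := fun y : ℝ => (1 - y ^ 2) ^ s * (y - x) ^ (-(1 + 2 * s))) ?_ ?_ ?_
    · simp only [Function.comp_def] at e2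
      have f1 : x + A / (1 + x) = 1 := by
        have : 1 + x ≠ 0 := by linarith
        rw [hA]; field_simp; ring
      have f2 : x + A / (R - x + x) = x + ε := by
        rw [sub_add_cancel, hRd, div_div_cancel₀ hAp.ne']
      rw [f1, f2] at e2
      rw [e1, intervalIntegral.integral_symm, ← e2, ← intervalIntegral.integral_neg,
        ← intervalIntegral.integral_const_mul]
      rw [intervalIntegral.integral_of_le (by linarith), intervalIntegral.integral_of_le (by linarith)]
      apply setIntegral_congr_fun measurableSet_Ioc
      intro q hq
      have hq1 : 1 < q := hq.1
      have hp : 0 < q ^ 2 - 1 := by nlinarith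
      have hp2 : 0 < q + x := by linarith
      simp only
      have g1 : 1 - (x + A / (q + x)) ^ 2 = A * (q ^ 2 - 1) / (q + x) ^ 2 := by
        rw [hA]; field_simp; ring
      have g2 : x + A / (q + x) - x = A / (q + x) := by ring
      rw [g1, g2, Real.div_rpow (by positivity) (by positivity), Real.mul_rpow hAp.le hp.le,
        Real.div_rpow hAp.le hp2.le, Real.rpow_neg hAp.le, Real.rpow_neg hp2.le,
        Real.rpow_one_add' hAp.le (by linarith), Real.rpow_one_add' hp2.le (by linarith),
        Real.rpow_mul hp2.le, Real.rpow_two, show 2 * s = s + s by ring, Real.rpow_add hAp]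
      have a1 : 0 < ((q + x) ^ 2) ^ s := by positivity
      have a2 : 0 < A ^ s := by positivity
      field_simp
    · rw [Set.uIcc_of_le (by linarith)]
      apply ContinuousOn.add (by fun_prop)
      apply ContinuousOn.div (by fun_prop) (by fun_prop)
      intro q hq
      have := hq.1
      linarith
    · intro q hq
      rw [min_eq_left (by linarith)] at hq
      have hq1 : 1 < q := hq.1
      have hp2 : q + x ≠ 0 := by linarith
      have h := ((hasDerivAt_const q A).div ((hasDerivAt_id q).add_const x) hp2).const_add x
      convert! h using 1
      simp
    · intro q hq
      rw [neg_div]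
      have : 0 ≤ A / (q + x) ^ 2 := by positivity
      linarith
  constructor
  · exact IntegrableOn.congr_fun ((hK.const_mul (auxW s x)).sub hWK) hcongr measurableSet_Ioi
  · rw [← setIntegral_congr_fun measurableSet_Ioi hcongr, integral_sub (hK.const_mul (auxW s x)) hWK,
      integral_const_mul, hKint, hWint, mul_sub]
    congr 1
    have : auxW s x = A ^ s := by simp [auxW, hx, hA]
    rw [this, hRd, Real.div_rpow hAp.le he.le, Real.rpow_neg he.le, show 2 * s = s + s by ring,
      Real.rpow_add hAp]
    have a2 : 0 < A ^ s := by positivity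
    field_simp

lemma aux_set (x ε : ℝ) : {y : ℝ | ε ≤ |x - y|} = Set.Iic (x - ε) ∪ Set.Ici (x + ε) := by
  ext y
  simp only [Set.mem_ofPred_eq, Set.mem_union, Set.mem_Iic, Set.mem_Ici, le_abs]
  constructor
  · rintro (h | h)
    · left; linarith
    · right; linarith
  · rintro (h | h)
    · left; linarith
    · right; linarith

lemma aux_full (s : ℝ) (h0 : 0 < s) (x ε : ℝ) (hx : |x| < 1) (he : 0 < ε)
    (he1 : ε < 1 - x) (he2 : ε < 1 + x) :
    ∫ y in {y : ℝ | ε ≤ |x - y|}, (auxW s x - auxW s y) / |x - y| ^ (1 + 2 * s) =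
      ((1 - x ^ 2) ^ s)⁻¹ * (((1 - x ^ 2) / ε) ^ (2 * s) / s -
        (∫ q in (1:ℝ)..((1 - x ^ 2) / ε + x), (q ^ 2 - 1) ^ s / (q - x)) -
        ∫ q in (1:ℝ)..((1 - x ^ 2) / ε - x), (q ^ 2 - 1) ^ s / (q + x)) := by
  obtain ⟨r1, r2⟩ := aux_right s h0 x ε hx he he1
  obtain ⟨l1, l2⟩ := aux_right s h0 (-x) ε (by rwa [abs_neg]) he (by linarith)
  have hf : ∀ y, (auxW s (-x) - auxW s (-y)) / |-x - -y| ^ (1 + 2 * s) =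
      (auxW s x - auxW s y) / |x - y| ^ (1 + 2 * s) := by
    intro y
    rw [auxW_neg, auxW_neg, show -x - -y = -(x - y) by ring, abs_neg]
  have l2' := integral_comp_neg_Iic (x - ε)
    (fun y => (auxW s (-x) - auxW s y) / |-x - y| ^ (1 + 2 * s))
  simp only [hf] at l2'
  rw [show -(x - ε) = -x + ε by ring, l2] at l2'
  have l1' : IntegrableOn (fun y => (auxW s x - auxW s y) / |x - y| ^ (1 + 2 * s)) (Set.Iic (x - ε)) := by
    have h := l1.comp_neg
    simp only [hf] at h
    have h3 : -(Set.Ioi (-x + ε)) = Set.Iio (x - ε) := by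
      ext y; simp; constructor <;> intro h <;> linarith
    rw [h3] at h
    exact (integrableOn_Iic_iff_integrableOn_Iio (by simp)).2 h
  rw [aux_set, setIntegral_union _ measurableSet_Ici l1' ((integrableOn_Ici_iff_integrableOn_Ioi (by simp)).2 r1),
    integral_Ici_eq_integral_Ioi, r2, l2']
  · simp only [neg_sq, sub_neg_eq_add, ← sub_eq_add_neg]
    field_simp
    ring
  · rw [Set.disjoint_left]
    intro y h1 h2
    simp at h1 h2
    linarith

theorem stmt8 (s : ℝ) (hs : s ∈ Set.Ioo (0 : ℝ) 1)
    (γ : ℝ)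
    (hγ : γ = (2 : ℝ) ^ (-(2 * s)) * Real.sqrt Real.pi /
      (Real.Gamma ((1 + 2 * s) / 2) * Real.Gamma (1 + s)))
    (u : ℝ → ℝ)
    (hu : ∀ y : ℝ, u y = if |y| < 1 then γ * (1 - y ^ 2) ^ s else 0) :
    ∀ x ∈ Set.Ioo (-1 : ℝ) 1,
      Tendsto (fun ε : ℝ =>
          (s * (4 : ℝ) ^ s * Real.Gamma ((1 + 2 * s) / 2) /
              (Real.sqrt Real.pi * Real.Gamma (1 - s))) *
            ∫ y in {y : ℝ | ε ≤ |x - y|}, (u x - u y) / |x - y| ^ (1 + 2 * s))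
        (𝓝[>] (0 : ℝ)) (𝓝 1) := by
  intro x hx
  obtain ⟨h0, h1⟩ := hs
  have hxa : |x| < 1 := abs_lt.2 hx
  have hxs : x ^ 2 < 1 := (sq_lt_one_iff_abs_lt_one x).2 hxa
  have hAp : 0 < 1 - x ^ 2 := by linarith
  have huw : ∀ y, u y = γ * auxW s y := by
    intro y
    rw [hu, auxW]
    split_ifs <;> simp
  have hRlim : Tendsto (fun ε : ℝ => (1 - x ^ 2) / ε) (𝓝[>] 0) atTop := by
    simp only [div_eq_mul_inv]
    exact tendsto_inv_nhdsGT_zero.const_mul_atTop hAp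
  have hl := (((aux_lim s h0 h1 x hxa).comp hRlim).const_mul (((1 - x ^ 2) ^ s)⁻¹)).const_mul
    (s * (4 : ℝ) ^ s * Real.Gamma ((1 + 2 * s) / 2) /
              (Real.sqrt Real.pi * Real.Gamma (1 - s)) * γ)
  have hconst : s * (4 : ℝ) ^ s * Real.Gamma ((1 + 2 * s) / 2) /
              (Real.sqrt Real.pi * Real.Gamma (1 - s)) * γ * (((1 - x ^ 2) ^ s)⁻¹ *
      ((1 - x ^ 2) ^ s * (Real.Gamma s * Real.Gamma (1 - s)))) = 1 := by
    have a1 : 0 < (1 - x ^ 2) ^ s := by positivity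
    have a2 : 0 < Real.Gamma s := Real.Gamma_pos_of_pos h0
    have a3 : 0 < Real.Gamma (1 - s) := Real.Gamma_pos_of_pos (by linarith)
    have a4 : 0 < Real.Gamma ((1 + 2 * s) / 2) := Real.Gamma_pos_of_pos (by linarith)
    have a5 : 0 < Real.sqrt Real.pi := Real.sqrt_pos.2 Real.pi_pos
    have a6 : Real.Gamma (1 + s) = s * Real.Gamma s := by
      rw [add_comm, Real.Gamma_add_one h0.ne']
    have a7 : (2 : ℝ) ^ (-(2 * s)) = ((4 : ℝ) ^ s)⁻¹ := by
      rw [Real.rpow_neg (by norm_num), Real.rpow_mul (by norm_num)]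
      norm_num
    have a8 : 0 < (4 : ℝ) ^ s := by positivity
    rw [hγ, a6, a7]
    field_simp
  rw [hconst] at hl
  refine hl.congr' ?_
  have hm : 0 < min (1 - x) (1 + x) := lt_min (by linarith [hx.2]) (by linarith [hx.1])
  filter_upwards [Ioo_mem_nhdsGT hm] with ε hε
  have e1 := lt_of_lt_of_le hε.2 (min_le_left _ _)
  have e2 := lt_of_lt_of_le hε.2 (min_le_right _ _)
  have hfull := aux_full s h0 x ε hxa hε.1 e1 e2
  simp only [Function.comp_apply]
  rw [← hfull, mul_assoc _ γ, ← integral_const_mul]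
  congr 2
  ext y
  rw [huw, huw]
  ring
end

section
/- (Fractional divergence theorem) Let d ≥ 1, s ∈ (0,1), and let Ω ⊂ ℝ^d be a nonempty bounded open set whose topological boundary has Lebesgue measure zero. Let u : ℝ^d → ℝ be twice continuously differentiable, with u and all its first and second order partial derivatives bounded, and with u(x) → 0 as |x| → ∞. Assume moreover that ∫_Ω ∫_{ℝ^d∖Ω} |u(x)−u(y)|/|x−y|^{d+2s} dy dx < ∞. Then for every x ∈ ℝ^d the principal-value limit (−Δ)^s u(x) exists, the function x ↦ (−Δ)^s u(x) is integrable on Ω, the function N_s u is integrable on ℝ^d ∖ closure(Ω), and ∫_Ω (−Δ)^s u dx = −∫_{ℝ^d∖closure(Ω)} N_s u dx. -/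
open MeasureTheory Filter Topology

/-- The normalization constant `C_{d,s} = s·4^s·Γ((d+2s)/2) / (π^{d/2}·Γ(1−s))`. -/
noncomputable def fracConst (d : ℕ) (s : ℝ) : ℝ :=
  s * (4 : ℝ) ^ s * Real.Gamma (((d : ℝ) + 2 * s) / 2) /
    (Real.pi ^ ((d : ℝ) / 2) * Real.Gamma (1 - s))

/-- The non-local normal derivative
`N_s u(x) = C_{d,s} ∫_Ω (u(x)−u(y))/|x−y|^{d+2s} dy`. -/
noncomputable def nonlocalNormalDeriv (d : ℕ) (s : ℝ)
    (Ω : Set (EuclideanSpace ℝ (Fin d))) (u : EuclideanSpace ℝ (Fin d) → ℝ)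
    (x : EuclideanSpace ℝ (Fin d)) : ℝ :=
  fracConst d s * ∫ y in Ω, (u x - u y) / ‖x - y‖ ^ ((d : ℝ) + 2 * s)


lemma H_integrable (d : ℕ) (hd : 1 ≤ d) (s : ℝ) (hs : s ∈ Set.Ioo (0 : ℝ) 1) :
    Integrable (fun z : EuclideanSpace ℝ (Fin d) => min (‖z‖^2) 1 / ‖z‖ ^ ((d : ℝ) + 2 * s)) := by
  have : Nonempty (Fin d) := ⟨⟨0, hd⟩⟩
  obtain ⟨h0, h1⟩ := hs
  have key := integrable_fun_norm_addHaar (volume : Measure (EuclideanSpace ℝ (Fin d)))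
    (f := fun r : ℝ => min (r^2) 1 / r ^ ((d : ℝ) + 2 * s))
  rw [key, finrank_euclideanSpace, Fintype.card_fin]
  have e : ∀ r : ℝ, 0 < r → r ^ (d - 1) = r ^ ((d : ℝ) - 1) := by
    intro r hr
    rw [← Real.rpow_natCast, Nat.cast_sub hd, Nat.cast_one]
  rw [← Set.Ioc_union_Ioi_eq_Ioi (zero_le_one' ℝ)]
  refine IntegrableOn.union ?_ ?_
  · have := (intervalIntegral.intervalIntegrable_rpow' (a := 0) (b := 1) (r := 1 - 2 * s) (by linarith)).1
    refine this.congr_fun ?_ measurableSet_Ioc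
    intro r hr
    have hr0 := hr.1
    simp only [smul_eq_mul]
    rw [e r hr0, min_eq_left (by nlinarith [hr.2]), ← Real.rpow_two, ← Real.rpow_sub hr0, ← Real.rpow_add hr0]
    congr 1; ring
  · have := integrableOn_Ioi_rpow_of_lt (a := -1 - 2 * s) (by linarith) (zero_lt_one' ℝ)
    refine this.congr_fun ?_ measurableSet_Ioi
    intro r hr
    have hr1 : 1 < r := hr
    have hr0 : 0 < r := by linarith
    simp only [smul_eq_mul]
    rw [e r hr0, min_eq_right (by nlinarith), one_div, ← Real.rpow_neg hr0.le, ← Real.rpow_add hr0]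
    congr 1; ring

lemma second_diff {d : ℕ} (u : EuclideanSpace ℝ (Fin d) → ℝ)
    (hu : ContDiff ℝ 2 u) (M : ℝ) (hM : ∀ x, ‖iteratedFDeriv ℝ 2 u x‖ ≤ M) (x z : EuclideanSpace ℝ (Fin d)) :
    |2 * u x - u (x + z) - u (x - z)| ≤ M * ‖z‖ ^ 2 := by
  have hdu : Differentiable ℝ u := hu.differentiable (by norm_num)
  have hd1 : ContDiff ℝ 1 (fderiv ℝ u) := hu.fderiv_right (by norm_num)
  have hd2 : Differentiable ℝ (fderiv ℝ u) := hd1.differentiable (by norm_num)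
  have b2 : ∀ w, ‖fderiv ℝ (fderiv ℝ u) w‖ ≤ M := by
    intro w
    rw [← norm_iteratedFDeriv_one, norm_iteratedFDeriv_fderiv]
    exact hM w
  have lip : ∀ a b, ‖fderiv ℝ u b - fderiv ℝ u a‖ ≤ M * ‖b - a‖ := fun a b =>
    Convex.norm_image_sub_le_of_norm_fderiv_le (fun w _ => hd2 w) (fun w _ => b2 w) convex_univ
      (Set.mem_univ a) (Set.mem_univ b)
  have hv : ∀ w, HasFDerivAt (fun w => u (w + z) - u w) (fderiv ℝ u (w + z) - fderiv ℝ u w) w := by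
    intro w
    refine HasFDerivAt.sub ?_ (hdu w).hasFDerivAt
    exact (hasFDerivAt_comp_add_right z).2 (hdu (w + z)).hasFDerivAt
  have := Convex.norm_image_sub_le_of_norm_hasFDerivWithin_le (f := fun w => u (w + z) - u w)
    (C := M * ‖z‖) (fun w _ => (hv w).hasFDerivWithinAt)
    (fun w _ => by simpa using lip w (w + z)) convex_univ
      (Set.mem_univ (x - z)) (Set.mem_univ x)
  simp only [sub_add_cancel, sub_sub_cancel, Real.norm_eq_abs] at this
  calc _ = |u (x + z) - u x - (u x - u (x - z))| := by rw [← abs_neg]; congr 1; ring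
    _ ≤ _ := this
    _ = _ := by ring

lemma sym_avg {d : ℕ} (u k : EuclideanSpace ℝ (Fin d) → ℝ) (hu : Continuous u) (M : ℝ)
    (hM : ∀ x, |u x| ≤ M) (hk : Integrable k) (hke : ∀ z, k (-z) = k z) (x : EuclideanSpace ℝ (Fin d)) :
    Integrable (fun y => (u x - u y) * k (x - y)) ∧
    ∫ y, (u x - u y) * k (x - y) = ∫ z, (2 * u x - u (x + z) - u (x - z)) / 2 * k z := by
  have i1 : Integrable (fun z => (u x - u (x - z)) * k z) := by
    refine hk.bdd_mul (c := M + M) (by fun_prop) ?_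
    refine Eventually.of_forall fun z => ?_
    exact (norm_sub_le _ _).trans (add_le_add (hM _) (hM _))
  have i2 : Integrable (fun z => (u x - u (x + z)) * k z) := by
    simpa [hke] using i1.comp_neg
  have e1 : ∫ y, (u x - u y) * k (x - y) = ∫ z, (u x - u (x - z)) * k z := by
    rw [← integral_sub_left_eq_self (fun z => (u x - u (x - z)) * k z) volume x]
    simp
  have e2 : ∫ z, (u x - u (x - z)) * k z = ∫ z, (u x - u (x + z)) * k z := by
    rw [← integral_neg_eq_self (fun z => (u x - u (x - z)) * k z) volume]
    simp [hke]
  refine ⟨by simpa using i1.comp_sub_left x, ?_⟩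
  have : ∫ z, (2 * u x - u (x + z) - u (x - z)) / 2 * k z
      = 2⁻¹ * ((∫ z, (u x - u (x - z)) * k z) + ∫ z, (u x - u (x + z)) * k z) := by
    rw [← integral_add i1 i2, ← integral_const_mul]
    congr 1; ext z; ring
  rw [this, e1, ← e2]; ring

/-- Truncated kernel. -/
noncomputable def truncKer (d : ℕ) (p ε : ℝ) (z : EuclideanSpace ℝ (Fin d)) : ℝ :=
  if ε ≤ ‖z‖ then (‖z‖ ^ p)⁻¹ else 0

lemma truncKer_meas (d : ℕ) (p ε : ℝ) : Measurable (truncKer d p ε) := by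
  unfold truncKer
  refine Measurable.ite (measurableSet_le measurable_const measurable_norm) ?_ measurable_const
  fun_prop

lemma truncKer_neg (d : ℕ) (p ε : ℝ) (z) : truncKer d p ε (-z) = truncKer d p ε z := by
  simp [truncKer]

lemma truncKer_nonneg (d : ℕ) (p ε : ℝ) (z) : 0 ≤ truncKer d p ε z := by
  unfold truncKer; split_ifs <;> positivity

lemma truncKer_le (d : ℕ) (p ε : ℝ) (z) : truncKer d p ε z ≤ (‖z‖ ^ p)⁻¹ := by
  unfold truncKer; split_ifs <;> first | exact le_rfl | positivity

lemma truncKer_le_const (d : ℕ) (p ε : ℝ) (hp : 0 < p) (hε : 0 < ε) (z) :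
    truncKer d p ε z ≤ (ε ^ p)⁻¹ := by
  unfold truncKer; split_ifs with h
  · gcongr
  · positivity

lemma truncKer_tendsto (d : ℕ) (p : ℝ) (hp : 0 < p) (z) :
    Tendsto (fun ε => truncKer d p ε z) (𝓝[>] 0) (𝓝 ((‖z‖ ^ p)⁻¹)) := by
  by_cases hz : z = 0
  · subst hz
    have : (fun ε => truncKer d p ε 0) = fun _ => 0 := by
      ext ε; simp [truncKer, Real.zero_rpow hp.ne']
    rw [this]; simp [Real.zero_rpow hp.ne']
  · refine tendsto_const_nhds.congr' ?_
    have : ∀ᶠ ε in 𝓝[>] (0:ℝ), ε < ‖z‖ :=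
      nhdsWithin_le_nhds (gt_mem_nhds (norm_pos_iff.2 hz))
    filter_upwards [this] with ε h
    simp [truncKer, h.le]

lemma truncKer_integrable (d : ℕ) (hd : 1 ≤ d) (s : ℝ) (hs : s ∈ Set.Ioo (0 : ℝ) 1) (ε : ℝ)
    (hε : 0 < ε) : Integrable (truncKer d ((d : ℝ) + 2 * s) ε) := by
  refine ((H_integrable d hd s hs).const_mul ((min (ε^2) 1)⁻¹)).mono'
    (truncKer_meas _ _ _).aestronglyMeasurable (Eventually.of_forall fun z => ?_)
  rw [Real.norm_of_nonneg (truncKer_nonneg _ _ _ _)]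
  have h0 : 0 < min (ε^2) 1 := by positivity
  unfold truncKer
  split_ifs with h
  · rw [div_eq_mul_inv, ← mul_assoc]
    refine le_mul_of_one_le_left (by positivity) ?_
    rw [← div_eq_inv_mul, one_le_div h0]
    gcongr
  · positivity

lemma antisymm_zero {d : ℕ} (μ : Measure (EuclideanSpace ℝ (Fin d))) [SFinite μ]
    (F : EuclideanSpace ℝ (Fin d) × EuclideanSpace ℝ (Fin d) → ℝ)
    (hF : Integrable F (μ.prod μ)) (ha : ∀ x y, F (y, x) = - F (x, y)) :
    ∫ x, ∫ y, F (x, y) ∂μ ∂μ = 0 := by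
  have h := integral_integral_swap (f := fun x y => F (x, y)) hF
  have h2 : ∫ y, ∫ x, F (x, y) ∂μ ∂μ = - ∫ x, ∫ y, F (x, y) ∂μ ∂μ := by
    rw [← integral_neg]
    congr 1; ext y
    rw [← integral_neg]
    congr 1; ext x
    exact ha y x
  linarith

/-- fractional divergence theorem: for `u ∈ C²` with bounded
derivatives up to order two, vanishing at infinity, and satisfying the
interaction integrability condition, the principal-value fractional Laplacian
`(−Δ)^s u` exists everywhere, is integrable on `Ω`, `N_s u` is integrable on
`ℝ^d ∖ closure Ω`, and `∫_Ω (−Δ)^s u dx = −∫_{ℝ^d∖closure Ω} N_s u dx`. -/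
theorem stmt9 (d : ℕ) (hd : 1 ≤ d) (s : ℝ) (hs : s ∈ Set.Ioo (0 : ℝ) 1)
    (Ω : Set (EuclideanSpace ℝ (Fin d))) (hΩopen : IsOpen Ω)
    (hΩbdd : Bornology.IsBounded Ω) (hΩne : Ω.Nonempty)
    (hfr : volume (frontier Ω) = 0)
    (u : EuclideanSpace ℝ (Fin d) → ℝ)
    (hu : ContDiff ℝ 2 u)
    (hbd : ∀ i : ℕ, i ≤ 2 → ∃ M : ℝ, ∀ x, ‖iteratedFDeriv ℝ i u x‖ ≤ M)
    (hvanish : Tendsto u (Filter.cocompact (EuclideanSpace ℝ (Fin d))) (𝓝 0))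
    (hint : ∫⁻ x in Ω, ∫⁻ y in Ωᶜ,
        ENNReal.ofReal (|u x - u y| / ‖x - y‖ ^ ((d : ℝ) + 2 * s)) ≠ ⊤) :
    ∃ Lu : EuclideanSpace ℝ (Fin d) → ℝ,
      (∀ x : EuclideanSpace ℝ (Fin d),
        Tendsto (fun ε : ℝ => fracConst d s *
            ∫ y in {y : EuclideanSpace ℝ (Fin d) | ε ≤ ‖x - y‖},
              (u x - u y) / ‖x - y‖ ^ ((d : ℝ) + 2 * s))
          (𝓝[>] (0 : ℝ)) (𝓝 (Lu x))) ∧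
      IntegrableOn Lu Ω ∧
      IntegrableOn (nonlocalNormalDeriv d s Ω u) (closure Ω)ᶜ ∧
      ∫ x in Ω, Lu x = -∫ x in (closure Ω)ᶜ, nonlocalNormalDeriv d s Ω u x := by
  
  classical
  obtain ⟨M0, hM0⟩ := hbd 0 (by norm_num)
  obtain ⟨M2, hM2⟩ := hbd 2 le_rfl
  have hub : ∀ x, |u x| ≤ M0 := fun x => by
    have := hM0 x; rwa [norm_iteratedFDeriv_zero, Real.norm_eq_abs] at this
  have huc : Continuous u := hu.continuous
  have hum : Measurable u := huc.measurable
  set p : ℝ := (d : ℝ) + 2 * s with hp_def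
  have hp : 0 < p := by have := hs.1; positivity
  set C : ℝ := max (M2 / 2) (2 * M0) with hC
  set H : EuclideanSpace ℝ (Fin d) → ℝ := fun z => min (‖z‖^2) 1 / ‖z‖ ^ p with hH
  have hHi : Integrable H := H_integrable d hd s hs
  have hM0n : 0 ≤ M0 := (abs_nonneg _).trans (hub 0)
  have hCn : 0 ≤ C := le_max_of_le_right (by linarith)
  let D : EuclideanSpace ℝ (Fin d) → EuclideanSpace ℝ (Fin d) → ℝ :=
    fun x z => (2 * u x - u (x + z) - u (x - z)) / 2
  have hD : ∀ x z, |D x z| ≤ C * min (‖z‖^2) 1 := by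
    intro x z
    have h1 := second_diff u hu M2 hM2 x z
    have h2 : |2 * u x - u (x + z) - u (x - z)| ≤ 4 * M0 := by
      have a := abs_le.1 (hub x)
      have b := abs_le.1 (hub (x + z))
      have c := abs_le.1 (hub (x - z))
      rw [abs_le]; constructor <;> linarith [a.1, a.2, b.1, b.2, c.1, c.2]
    simp only [D, abs_div, abs_two]
    rcases min_cases (‖z‖^2) 1 with h | h <;> rw [h.1]
    · have : M2 / 2 * ‖z‖^2 ≤ C * ‖z‖^2 := by gcongr; exact le_max_left _ _
      linarith
    · have : 2 * M0 ≤ C := le_max_right _ _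
      linarith
  have hDk : ∀ x ε z, ‖D x z * truncKer d p ε z‖ ≤ C * H z := by
    intro x ε z
    rw [norm_mul, Real.norm_eq_abs, Real.norm_of_nonneg (truncKer_nonneg _ _ _ _), hH]
    simp only [div_eq_mul_inv, ← mul_assoc]
    exact mul_le_mul (hD x z) (truncKer_le _ _ _ _) (truncKer_nonneg _ _ _ _) (by positivity)
  have hDm : Measurable (Function.uncurry D) := by
    simp only [D, Function.uncurry_def]; fun_prop
  have hDm1 : ∀ x, Measurable (D x) := by
    intro x; simp only [D]; fun_prop
  -- truncated operators
  let Lε : ℝ → EuclideanSpace ℝ (Fin d) → ℝ := fun ε x => ∫ z, D x z * truncKer d p ε z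
  let L : EuclideanSpace ℝ (Fin d) → ℝ := fun x => ∫ z, D x z * (‖z‖ ^ p)⁻¹
  have hLlim : ∀ x, Tendsto (fun ε => Lε ε x) (𝓝[>] 0) (𝓝 (L x)) := by
    intro x
    refine tendsto_integral_filter_of_dominated_convergence (fun z => C * H z) ?_ ?_
      (hHi.const_mul C) ?_
    · exact Eventually.of_forall fun ε =>
        ((hDm1 x).mul (truncKer_meas d p ε)).aestronglyMeasurable
    · exact Eventually.of_forall fun ε => Eventually.of_forall fun z => hDk x ε z
    · exact Eventually.of_forall fun z => (truncKer_tendsto d p hp z).const_mul _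
  have hLb : ∀ ε x, ‖Lε ε x‖ ≤ ∫ z, C * H z := by
    intro ε x
    exact norm_integral_le_of_norm_le (hHi.const_mul C) (Eventually.of_forall fun z => hDk x ε z)
  have hLbb : ∀ x, ‖L x‖ ≤ ∫ z, C * H z := fun x =>
    le_of_tendsto (hLlim x).norm (Eventually.of_forall fun ε => hLb ε x)
  have hLεm : ∀ ε, StronglyMeasurable (Lε ε) := by
    intro ε
    refine StronglyMeasurable.integral_prod_right (f := fun x z => D x z * truncKer d p ε z) ?_
    exact (hDm.mul ((truncKer_meas d p ε).comp measurable_snd)).stronglyMeasurable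
  have hLm : StronglyMeasurable L := by
    refine StronglyMeasurable.integral_prod_right (f := fun x z => D x z * (‖z‖ ^ p)⁻¹) ?_
    refine (hDm.mul (g := fun q => (‖q.2‖ ^ p)⁻¹) ?_).stronglyMeasurable
    fun_prop
  have hΩm := hΩopen.measurableSet
  have hΩfin : volume Ω < ⊤ := hΩbdd.measure_lt_top
  have : IsFiniteMeasure (volume.restrict Ω) := ⟨by simpa using hΩfin⟩
  have hLint : IntegrableOn L Ω :=
    Integrable.of_bound hLm.aestronglyMeasurable _ (Eventually.of_forall hLbb)
  -- the two-point function
  let F : ℝ → EuclideanSpace ℝ (Fin d) × EuclideanSpace ℝ (Fin d) → ℝ :=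
    fun ε q => (u q.1 - u q.2) * truncKer d p ε (q.1 - q.2)
  let F0 : EuclideanSpace ℝ (Fin d) × EuclideanSpace ℝ (Fin d) → ℝ :=
    fun q => (u q.1 - u q.2) / ‖q.1 - q.2‖ ^ p
  have hFm : ∀ ε, Measurable (F ε) := by
    intro ε
    have := (truncKer_meas d p ε).comp
      (measurable_fst.sub measurable_snd : Measurable (fun q : EuclideanSpace ℝ (Fin d) ×
        EuclideanSpace ℝ (Fin d) => q.1 - q.2))
    exact Measurable.mul (by fun_prop) this
  have hF0m : Measurable F0 := by
    simp only [F0]; fun_prop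
  have hFF0 : ∀ ε q, ‖F ε q‖ ≤ ‖F0 q‖ := by
    intro ε q
    simp only [F, F0, div_eq_mul_inv, norm_mul]
    rw [Real.norm_of_nonneg (truncKer_nonneg _ _ _ _), Real.norm_of_nonneg (by positivity : 0 ≤ (‖q.1 - q.2‖ ^ p)⁻¹)]
    gcongr
    exact truncKer_le _ _ _ _
  have hsa : ∀ ε, 0 < ε → ∀ x, Integrable (fun y => F ε (x, y)) ∧ ∫ y, F ε (x, y) = Lε ε x :=
    fun ε hε x => sym_avg u (truncKer d p ε) huc M0 hub
      (truncKer_integrable d hd s hs ε hε) (truncKer_neg d p ε) x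
  have hF0i : Integrable F0 ((volume.restrict Ω).prod (volume.restrict Ωᶜ)) := by
    refine ⟨hF0m.aestronglyMeasurable, ?_⟩
    rw [HasFiniteIntegral, lintegral_prod _ hF0m.enorm.aemeasurable, lt_top_iff_ne_top]
    have heq : ∀ x y, ‖F0 (x, y)‖ₑ = ENNReal.ofReal (|u x - u y| / ‖x - y‖ ^ p) := fun x y => by
      rw [Real.enorm_eq_ofReal_abs, abs_div, abs_of_nonneg (by positivity : 0 ≤ ‖x - y‖ ^ p)]
    simp_rw [heq]
    exact hint
  have hFi : ∀ ε, Integrable (F ε) ((volume.restrict Ω).prod (volume.restrict Ωᶜ)) := fun ε =>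
    hF0i.mono (hFm ε).aestronglyMeasurable (Eventually.of_forall (hFF0 ε))
  have hFΩ : ∀ ε, 0 < ε → Integrable (F ε) ((volume.restrict Ω).prod (volume.restrict Ω)) := by
    intro ε hε
    refine Integrable.of_bound (hFm ε).aestronglyMeasurable ((M0 + M0) * (ε ^ p)⁻¹)
      (Eventually.of_forall fun q => ?_)
    simp only [F, norm_mul]
    rw [Real.norm_of_nonneg (truncKer_nonneg _ _ _ _)]
    refine mul_le_mul ((norm_sub_le _ _).trans (add_le_add (hub _) (hub _)))
      (truncKer_le_const d p ε hp hε _) (truncKer_nonneg _ _ _ _) (by linarith)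
  have hsplit : ∀ ε, 0 < ε → ∫ x in Ω, Lε ε x = ∫ x in Ω, ∫ y in Ωᶜ, F ε (x, y) := by
    intro ε hε
    have h1 : ∀ x, Lε ε x = (∫ y in Ω, F ε (x, y)) + ∫ y in Ωᶜ, F ε (x, y) := fun x => by
      rw [← (hsa ε hε x).2, integral_add_compl hΩm (hsa ε hε x).1]
    simp_rw [h1]
    rw [integral_add (hFΩ ε hε).integral_prod_left (hFi ε).integral_prod_left,
      antisymm_zero _ (F ε) (hFΩ ε hε), zero_add]
    intro x y
    simp only [F]
    rw [← neg_sub x y, truncKer_neg]; ring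
  have hlim1 : Tendsto (fun ε => ∫ x in Ω, Lε ε x) (𝓝[>] 0) (𝓝 (∫ x in Ω, L x)) := by
    refine tendsto_integral_filter_of_dominated_convergence (fun _ => ∫ z, C * H z) ?_ ?_
      (integrable_const _) ?_
    · exact Eventually.of_forall fun ε => (hLεm ε).aestronglyMeasurable
    · exact Eventually.of_forall fun ε => Eventually.of_forall fun x => hLb ε x
    · exact Eventually.of_forall hLlim
  have hlim2 : Tendsto (fun ε => ∫ x in Ω, ∫ y in Ωᶜ, F ε (x, y)) (𝓝[>] 0)
      (𝓝 (∫ x in Ω, ∫ y in Ωᶜ, F0 (x, y))) := by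
    have e : ∀ ε, ∫ x in Ω, ∫ y in Ωᶜ, F ε (x, y)
        = ∫ q, F ε q ∂((volume.restrict Ω).prod (volume.restrict Ωᶜ)) :=
      fun ε => (integral_prod _ (hFi ε)).symm
    simp_rw [e]
    rw [← integral_prod _ hF0i]
    refine tendsto_integral_filter_of_dominated_convergence (fun q => ‖F0 q‖) ?_ ?_ hF0i.norm ?_
    · exact Eventually.of_forall fun ε => (hFm ε).aestronglyMeasurable
    · exact Eventually.of_forall fun ε => Eventually.of_forall fun x => hFF0 ε x
    · exact Eventually.of_forall fun q => by
        simp only [F0, div_eq_mul_inv]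
        exact (truncKer_tendsto d p hp _).const_mul _
  have hmain : ∫ x in Ω, L x = ∫ x in Ω, ∫ y in Ωᶜ, F0 (x, y) := by
    refine tendsto_nhds_unique hlim1 (hlim2.congr' ?_)
    filter_upwards [self_mem_nhdsWithin] with ε hε
    exact (hsplit ε hε).symm
  have hN : nonlocalNormalDeriv d s Ω u = fun y => -(fracConst d s * ∫ x in Ω, F0 (x, y)) := by
    ext y
    rw [nonlocalNormalDeriv, ← mul_neg, ← integral_neg]
    congr 2; ext x
    simp only [F0]
    rw [norm_sub_rev x y]; ring
  have hae : ((closure Ω)ᶜ : Set (EuclideanSpace ℝ (Fin d))) =ᵐ[volume] (Ωᶜ : Set _) := by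
    refine Filter.EventuallyEq.compl ?_
    exact (closure_ae_eq_of_null_frontier hfr)
  have hres : volume.restrict (closure Ω)ᶜ = volume.restrict Ωᶜ := Measure.restrict_congr_set hae
  have hsw := integral_integral_swap (f := fun x y => F0 (x, y)) hF0i
  refine ⟨fun x => fracConst d s * L x, ?_, hLint.const_mul _, ?_, ?_⟩
  · intro x
    refine ((hLlim x).const_mul (fracConst d s)).congr' ?_
    filter_upwards [self_mem_nhdsWithin] with ε hε
    rw [← (hsa ε hε x).2, ← integral_indicator
      (measurableSet_le measurable_const (by fun_prop))]
    congr 2; ext y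
    by_cases h : ε ≤ ‖x - y‖ <;> simp [F, truncKer, h, div_eq_mul_inv]
  · rw [IntegrableOn, hres, hN]
    exact (hF0i.integral_prod_right.const_mul _).neg
  · rw [hres, hN, integral_neg, neg_neg, integral_const_mul, integral_const_mul, hmain]
    rw [hsw]
end
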